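/- arXiv:1710.03913 — 4 statements merged into one kernel-verified Lean document; each statement's English description precedes it below -/
import Mathlib

section
/- The observable space W(H) equipped with D_W is a complete metric space: D_W(O,O') ≥ 0 with equality if and only if O = O', D_W is symmetric, D_W satisfies the triangle inequality, and every Cauchy sequence in (W(H), D_W) converges to an element of W(H). -/
/- STATEMENT 0: The observable space W(H) of complete orthonormal decompositions,
equipped with D_W, is a complete metric space. -/

noncomputable section

/-- The Hilbert space `ℂ^d`. -/
abbrev E (d : ℕ) : Type := EuclideanSpace ℂ (Fin d)

/-- Bounded operators on `ℂ^d`, with the operator norm. -/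
abbrev Op (d : ℕ) : Type := E d →L[ℂ] E d

/-- `p` is a rank-one orthogonal projection. -/
def IsProj1 {d : ℕ} (p : Op d) : Prop :=
  IsSelfAdjoint p ∧ p * p = p ∧ Module.finrank ℂ (LinearMap.range (p : E d →ₗ[ℂ] E d)) = 1

/-- `O` is a complete orthonormal decomposition in `ℂ^d`: a set of `d` rank-one
orthogonal projections, pairwise orthogonal, summing to the identity. -/
def IsCOD (d : ℕ) (O : Set (Op d)) : Prop :=
  O.Finite ∧ O.ncard = d ∧ (∀ p ∈ O, IsProj1 p) ∧
    (∀ p ∈ O, ∀ q ∈ O, p ≠ q → p * q = 0) ∧ (∑ᶠ p ∈ O, p) = 1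

/-- The distance `D_W(O,O') = inf {‖I - U‖ : U unitary, U⁻¹ O' U = O}`. -/
def DW {d : ℕ} (O O' : Set (Op d)) : ℝ :=
  sInf {r : ℝ | ∃ U : Op d, U ∈ unitary (Op d) ∧
    ((fun p => star U * p * U) '' O') = O ∧ r = ‖1 - U‖}

open Filter Topology InnerProductSpace

instance continuousStar_op (d : ℕ) : ContinuousStar (Op d) :=
  ⟨(ContinuousLinearMap.adjoint (𝕜 := ℂ) (E := E d) (F := E d)).continuous⟩

/-- A rank-one orthogonal projection is the projection onto the line of a unit vector. -/
theorem isProj1_iff_exists_rankOne {d : ℕ} {p : Op d} :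
    IsProj1 p ↔ ∃ v : E d, ‖v‖ = 1 ∧ p = rankOne ℂ v v := by
  constructor
  · rintro ⟨hsa, hidem, hrank⟩
    obtain ⟨⟨w, w', hw'⟩, hw0, hw⟩ := finrank_eq_one_iff'.1 hrank
    have hw0 : w ≠ 0 := fun h => hw0 (Subtype.ext h)
    have hnorm : ‖w‖ ≠ 0 := norm_ne_zero_iff.2 hw0
    have hpw : p w = w := by
      have h : (p * p) w' = p w' := by rw [hidem]
      have hw'' : p w' = w := hw'
      simpa [hw''] using h
    refine ⟨((‖w‖ : ℂ)⁻¹) • w, by simp [norm_smul, hnorm], ?_⟩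
    ext1 x
    obtain ⟨c, hc⟩ := hw ⟨p x, x, rfl⟩
    have hc : c • w = p x := congrArg Subtype.val hc
    have hin : inner ℂ w x = c * (‖w‖ : ℂ) ^ 2 := by
      have h : inner ℂ (p w) x = inner ℂ w (p x) := by
        have := ContinuousLinearMap.adjoint_inner_left p x w
        rwa [← ContinuousLinearMap.star_eq_adjoint, hsa.star_eq] at this
      rw [hpw] at h
      rw [h, ← hc, inner_smul_right, inner_self_eq_norm_sq_to_K]
      rfl
    have hn : (‖w‖ : ℂ) ≠ 0 := by exact_mod_cast hnorm
    rw [rankOne_apply, inner_smul_left, hin, smul_smul, ← hc]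
    congr 1
    simp
    field_simp
  · rintro ⟨v, hv, rfl⟩
    refine ⟨(isStarProjection_rankOne_self hv).isSelfAdjoint,
      isIdempotentElem_rankOne_self hv, ?_⟩
    have hv0 : v ≠ 0 := by
      rintro rfl
      simp at hv
    have := rank_rankOne (𝕜 := ℂ) hv0 hv0
    rwa [LinearMap.rank, Module.rank_eq_one_iff_finrank_eq_one] at this

/-- Every complete orthonormal decomposition consists of the projections onto the lines spanned
by an orthonormal basis. -/
theorem IsCOD.exists_orthonormalBasis {d : ℕ} {O : Set (Op d)} (hO : IsCOD d O) :
    ∃ b : OrthonormalBasis (Fin d) ℂ (E d),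
      O = Set.range fun i => (rankOne ℂ (b i) (b i) : Op d) := by
  obtain ⟨hfin, hcard, hproj, horth, -⟩ := hO
  have : Finite O := hfin
  let e : Fin d ≃ O := (Finite.equivFinOfCardEq (by rw [Nat.card_coe_set_eq, hcard])).symm
  choose v hv hpv using fun i => isProj1_iff_exists_rankOne.1 (hproj (e i) (e i).2)
  have hon : Orthonormal ℂ v := by
    refine ⟨hv, fun i j hij => ?_⟩
    have hne : (e i : Op d) ≠ e j := fun h => hij (e.injective (Subtype.ext h))
    have h := horth _ (e i).2 _ (e j).2 hne
    rw [hpv i, hpv j, ContinuousLinearMap.mul_def, rankOne_comp_rankOne] at h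
    have hvi : v i ≠ 0 := norm_ne_zero_iff.1 (by simp [hv])
    have hvj : v j ≠ 0 := norm_ne_zero_iff.1 (by simp [hv])
    exact (smul_eq_zero.1 h).resolve_right (rankOne_ne_zero hvi hvj)
  have hspan : ⊤ ≤ Submodule.span ℂ (Set.range v) :=
    (hon.linearIndependent.span_eq_top_of_card_eq_finrank' (by simp)).ge
  refine ⟨OrthonormalBasis.mk hon hspan, ?_⟩
  ext p
  simp only [OrthonormalBasis.coe_mk, Set.mem_range, ← hpv]
  exact ⟨fun hp => ⟨e.symm ⟨p, hp⟩, by simp⟩, by rintro ⟨i, rfl⟩; exact (e i).2⟩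

/-- The image `U⁻¹ O U` of a set of operators under conjugation by a unitary. -/
def unitaryConj {d : ℕ} (U : Op d) (O : Set (Op d)) : Set (Op d) :=
  (fun p => star U * p * U) '' O

theorem unitaryConj_one {d : ℕ} (O : Set (Op d)) : unitaryConj 1 O = O := by
  simp [unitaryConj]

theorem unitaryConj_mul {d : ℕ} (U V : Op d) (O : Set (Op d)) :
    unitaryConj (U * V) O = unitaryConj V (unitaryConj U O) := by
  simp only [unitaryConj, Set.image_image, star_mul, mul_assoc]

theorem unitaryConj_star {d : ℕ} {U : Op d} (hU : U ∈ unitary (Op d)) {O O' : Set (Op d)}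
    (h : unitaryConj U O' = O) : unitaryConj (star U) O = O' := by
  rw [← h, ← unitaryConj_mul, Unitary.mul_star_self_of_mem hU, unitaryConj_one]

/-- Conjugation of a rank-one projection by a unitary. -/
theorem star_mul_rankOne_mul {d : ℕ} (U : Op d) (v : E d) :
    star U * (rankOne ℂ v v : Op d) * U = rankOne ℂ (star U v) (star U v) := by
  simp only [ContinuousLinearMap.mul_def, comp_rankOne, rankOne_comp,
    ContinuousLinearMap.star_eq_adjoint]

/-- Any two complete orthonormal decompositions are unitarily conjugate. -/
theorem IsCOD.exists_unitary {d : ℕ} {O O' : Set (Op d)} (hO : IsCOD d O) (hO' : IsCOD d O') :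
    ∃ U ∈ unitary (Op d), unitaryConj U O' = O := by
  obtain ⟨b, rfl⟩ := hO.exists_orthonormalBasis
  obtain ⟨b', rfl⟩ := hO'.exists_orthonormalBasis
  let u : unitary (Op d) := Unitary.linearIsometryEquiv.symm (b'.equiv b (Equiv.refl _))
  have hu : ∀ i, (u : Op d) (b' i) = b i := by
    intro i
    exact (b'.equiv_apply_basis b (Equiv.refl _) i)
  refine ⟨star (u : Op d), Unitary.star_mem u.2, ?_⟩
  rw [unitaryConj, ← Set.range_comp]
  congr 1
  funext i
  rw [Function.comp_apply, star_mul_rankOne_mul, star_star, hu]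

/-- Conjugation by a unitary preserves complete orthonormal decompositions. -/
theorem isCOD_unitaryConj {d : ℕ} {O : Set (Op d)} (hO : IsCOD d O) {U : Op d}
    (hU : U ∈ unitary (Op d)) : IsCOD d (unitaryConj U O) := by
  obtain ⟨hfin, hcard, hproj, horth, hsum⟩ := hO
  have hUU : U * star U = 1 := Unitary.mul_star_self_of_mem hU
  let φ : Op d →+ Op d := (AddMonoidHom.mulRight U).comp (AddMonoidHom.mulLeft (star U))
  have hinj : Function.Injective fun p : Op d => star U * p * U := by
    intro p q h
    have h' : U * (star U * p * U) * star U = U * (star U * q * U) * star U :=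
      congrArg (fun x => U * x * star U) h
    simpa [mul_assoc, hUU, ← mul_assoc U (star U)] using h'
  refine ⟨hfin.image _, by rw [unitaryConj, Set.ncard_image_of_injective _ hinj, hcard],
    ?_, ?_, ?_⟩
  · rintro _ ⟨p, hp, rfl⟩
    obtain ⟨v, hv, rfl⟩ := isProj1_iff_exists_rankOne.1 (hproj p hp)
    refine isProj1_iff_exists_rankOne.2 ⟨star U v, ?_, star_mul_rankOne_mul U v⟩
    rw [ContinuousLinearMap.norm_map_of_mem_unitary (Unitary.star_mem hU), hv]
  · rintro _ ⟨p, hp, rfl⟩ _ ⟨q, hq, rfl⟩ hpq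
    have h := horth p hp q hq fun h => hpq (by rw [h])
    calc star U * p * U * (star U * q * U) = star U * p * (U * star U) * q * U := by
          simp only [mul_assoc]
      _ = star U * (p * q) * U := by rw [hUU]; simp only [mul_assoc, one_mul]
      _ = 0 := by simp [h]
  · rw [unitaryConj, finsum_mem_image hinj.injOn]
    have h := φ.map_finsum_mem id hfin
    simp only [id, hsum] at h
    simpa [φ, Unitary.star_mul_self_of_mem hU] using h.symm

theorem bddBelow_unitaryConj_norms {d : ℕ} (O O' : Set (Op d)) :
    BddBelow {r : ℝ | ∃ U : Op d, U ∈ unitary (Op d) ∧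
      ((fun p => star U * p * U) '' O') = O ∧ r = ‖1 - U‖} :=
  ⟨0, by rintro _ ⟨U, -, -, rfl⟩; exact norm_nonneg _⟩

theorem DW_nonneg {d : ℕ} (O O' : Set (Op d)) : 0 ≤ DW O O' :=
  Real.sInf_nonneg (by rintro _ ⟨U, -, -, rfl⟩; exact norm_nonneg _)

theorem DW_le_norm {d : ℕ} {O O' : Set (Op d)} {U : Op d} (hU : U ∈ unitary (Op d))
    (h : unitaryConj U O' = O) : DW O O' ≤ ‖1 - U‖ :=
  csInf_le (bddBelow_unitaryConj_norms O O') ⟨U, hU, h, rfl⟩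

theorem DW_self {d : ℕ} (O : Set (Op d)) : DW O O = 0 :=
  le_antisymm (by simpa using DW_le_norm (one_mem (unitary (Op d))) (unitaryConj_one O))
    (DW_nonneg O O)

/-- Unitaries conjugating `O'` to `O` come arbitrarily close to realizing `DW O O'`. -/
theorem IsCOD.exists_norm_lt {d : ℕ} {O O' : Set (Op d)} (hO : IsCOD d O) (hO' : IsCOD d O')
    {r : ℝ} (hr : DW O O' < r) :
    ∃ U ∈ unitary (Op d), unitaryConj U O' = O ∧ ‖1 - U‖ < r := by
  obtain ⟨U, hU, h⟩ := hO.exists_unitary hO'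
  obtain ⟨_, ⟨V, hV, hVO, rfl⟩, hlt⟩ := exists_lt_of_csInf_lt (by exact ⟨_, U, hU, h, rfl⟩) hr
  exact ⟨V, hV, hVO, hlt⟩

theorem IsCOD.DW_comm_le {d : ℕ} {O O' : Set (Op d)} (hO : IsCOD d O) (hO' : IsCOD d O') :
    DW O' O ≤ DW O O' := by
  refine le_of_forall_gt fun r hr => ?_
  obtain ⟨U, hU, h, hlt⟩ := hO.exists_norm_lt hO' hr
  refine (DW_le_norm (Unitary.star_mem hU) (unitaryConj_star hU h)).trans_lt ?_
  rwa [← norm_star, star_sub, star_star, star_one]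

theorem IsCOD.DW_triangle {d : ℕ} {O O' O'' : Set (Op d)} (hO : IsCOD d O) (hO' : IsCOD d O')
    (hO'' : IsCOD d O'') : DW O O'' ≤ DW O O' + DW O' O'' := by
  refine le_of_forall_pos_lt_add fun ε hε => ?_
  obtain ⟨U, hU, h, hlt⟩ := hO.exists_norm_lt hO' (lt_add_of_pos_right _ (half_pos hε))
  obtain ⟨V, hV, h', hlt'⟩ := hO'.exists_norm_lt hO'' (lt_add_of_pos_right _ (half_pos hε))
  have hle := DW_le_norm (mul_mem hV hU) (by rw [unitaryConj_mul, h', h])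
  have hnorm : ‖1 - V * U‖ ≤ ‖1 - U‖ + ‖1 - V‖ := by
    rw [← CStarRing.norm_mul_mem_unitary (1 - V) hU]
    refine (norm_add_le _ _).trans' (le_of_eq (congrArg _ ?_))
    simp [sub_mul]
  linarith

theorem IsCOD.subset_of_DW_eq_zero {d : ℕ} {O O' : Set (Op d)} (hO : IsCOD d O)
    (hO' : IsCOD d O') (h : DW O O' = 0) : O' ⊆ O := by
  have key : ∀ n : ℕ, ∃ U ∈ unitary (Op d), unitaryConj U O' = O ∧ ‖1 - U‖ < 1 / ((n : ℝ) + 1) :=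
    fun n => hO.exists_norm_lt hO' (by rw [h]; positivity)
  choose U hU hconj hlt using key
  have hlim : Tendsto U atTop (𝓝 1) := by
    rw [tendsto_iff_norm_sub_tendsto_zero]
    refine squeeze_zero (fun _ => norm_nonneg _) (fun n => ?_)
      tendsto_one_div_add_atTop_nhds_zero_nat
    rw [norm_sub_rev]
    exact (hlt n).le
  intro p hp
  have hp_lim : Tendsto (fun n => star (U n) * p * U n) atTop (𝓝 p) := by
    simpa using (hlim.star.mul_const p).mul hlim
  exact hO.1.isClosed.mem_of_tendsto hp_lim
    (Eventually.of_forall fun n => hconj n ▸ Set.mem_image_of_mem _ hp)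

theorem IsCOD.DW_eq_zero_iff {d : ℕ} {O O' : Set (Op d)} (hO : IsCOD d O) (hO' : IsCOD d O') :
    DW O O' = 0 ↔ O = O' := by
  refine ⟨fun h => ?_, fun h => h ▸ DW_self O⟩
  exact (Set.eq_of_subset_of_ncard_le (hO.subset_of_DW_eq_zero hO' h)
    (by rw [hO.2.1, hO'.2.1]) hO.1).symm

theorem isCompact_unitary_op (d : ℕ) : IsCompact (unitary (Op d) : Set (Op d)) := by
  have : ProperSpace (Op d) := FiniteDimensional.proper ℂ _
  refine (isCompact_closedBall (0 : Op d) 1).of_isClosed_subset isClosed_unitary fun U hU => ?_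
  rw [mem_closedBall_zero_iff]
  exact U.opNorm_le_bound zero_le_one fun x => by
    rw [ContinuousLinearMap.norm_map_of_mem_unitary hU, one_mul]

/-- Sequential compactness of the space of complete orthonormal decompositions. -/
theorem exists_subseq_DW_tendsto {d : ℕ} {f : ℕ → Set (Op d)} (hf : ∀ n, IsCOD d (f n)) :
    ∃ O, IsCOD d O ∧ ∃ φ : ℕ → ℕ, StrictMono φ ∧
      Tendsto (fun n => DW (f (φ n)) O) atTop (𝓝 0) := by
  choose U hU hconj using fun n => (hf n).exists_unitary (hf 0)
  obtain ⟨V, hV, φ, hφ, hlim⟩ := (isCompact_unitary_op d).tendsto_subseq hU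
  refine ⟨unitaryConj V (f 0), isCOD_unitaryConj (hf 0) hV, φ, hφ, ?_⟩
  have hle : ∀ n, DW (f (φ n)) (unitaryConj V (f 0)) ≤ ‖1 - star V * U (φ n)‖ := fun n =>
    DW_le_norm (mul_mem (Unitary.star_mem hV) (hU _))
      (by rw [unitaryConj_mul, unitaryConj_star hV rfl, hconj])
  refine squeeze_zero (fun _ => DW_nonneg _ _) hle ?_
  simpa [Unitary.star_mul_self_of_mem hV] using
    ((hlim.const_mul (star V)).const_sub 1).norm

/-- `(W(H), D_W)` is a complete metric space: nonnegativity, identity of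
indiscernibles, symmetry, the triangle inequality, and completeness. -/
theorem observable_space_complete_metric (d : ℕ) (hd : 1 ≤ d) :
    (∀ O O' : Set (Op d), IsCOD d O → IsCOD d O' → 0 ≤ DW O O') ∧
    (∀ O O' : Set (Op d), IsCOD d O → IsCOD d O' → (DW O O' = 0 ↔ O = O')) ∧
    (∀ O O' : Set (Op d), IsCOD d O → IsCOD d O' → DW O O' = DW O' O) ∧
    (∀ O O' O'' : Set (Op d), IsCOD d O → IsCOD d O' → IsCOD d O'' →
      DW O O'' ≤ DW O O' + DW O' O'') ∧
    (∀ f : ℕ → Set (Op d), (∀ n, IsCOD d (f n)) →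
      (∀ ε : ℝ, 0 < ε → ∃ N : ℕ, ∀ m ≥ N, ∀ n ≥ N, DW (f m) (f n) < ε) →
      ∃ O : Set (Op d), IsCOD d O ∧
        ∀ ε : ℝ, 0 < ε → ∃ N : ℕ, ∀ n ≥ N, DW (f n) O < ε) := by

  refine ⟨fun O O' _ _ => DW_nonneg O O', fun O O' hO hO' => hO.DW_eq_zero_iff hO',
    fun O O' hO hO' => le_antisymm (hO'.DW_comm_le hO) (hO.DW_comm_le hO'),
    fun O O' O'' hO hO' hO'' => hO.DW_triangle hO' hO'', fun f hf hcauchy => ?_⟩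
  obtain ⟨O, hO, φ, hφ, hlim⟩ := exists_subseq_DW_tendsto hf
  refine ⟨O, hO, fun ε hε => ?_⟩
  obtain ⟨N, hN⟩ := hcauchy (ε / 2) (half_pos hε)
  obtain ⟨k, hk, hkN⟩ :=
    ((hlim.eventually_lt_const (half_pos hε)).and (eventually_ge_atTop N)).exists
  refine ⟨N, fun n hn => ?_⟩
  have h := hN n hn (φ k) (hkN.trans (hφ.id_le k))
  linarith [(hf n).DW_triangle (hf (φ k)) hO]
end
end

section
/- Let h : [0,T] → self-adjoint operators on H be continuous, and let U : [0,T] → U(H) be differentiable with U(0) = I and i U'(t) = h(t) U(t). Let (ψ_1,…,ψ_d) be an orthonormal basis of H and θ_n ∈ ℝ with U(T)⁻¹ ψ_n = e^{iθ_n} ψ_n for each n (cyclicity of the observable evolution with period T). Set ψ_n(t) = U(t)⁻¹ ψ_n, δ_n(t) = ⟨ψ_n, h(t) ψ_n⟩, ψ̃_n(t) = exp(−i∫₀ᵗ δ_n(s) ds) ψ_n(t), and define the observable-geometric phase β_n = θ_n − ∫₀ᵀ δ_n(s) ds. Then for each n: (a) ⟨ψ̃_n(t), (d/dt)ψ̃_n(t)⟩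 = 0 for all t ∈ [0,T] (ψ̃_n is the parallel transport of ψ_n along the curve), and (b) ψ̃_n(T) = e^{iβ_n} ψ_n, i.e., e^{iβ_n} is the holonomy phase acquired by ψ_n under parallel transport around the closed curve of decompositions. -/
/- STATEMENT 16: For a cyclic evolution U with iU' = hU, U(0) = I, and
U(T)⁻¹ψ_n = e^{iθ_n}ψ_n, the vectors ψ̃_n(t) = e^{−i∫₀ᵗδ_n}U(t)⁻¹ψ_n (with
δ_n(t) = ⟨ψ_n, h(t)ψ_n⟩) are parallel-transported, ⟨ψ̃_n, dψ̃_n/dt⟩ = 0, and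
ψ̃_n(T) = e^{iβ_n}ψ_n with the observable-geometric phase β_n = θ_n − ∫₀ᵀδ_n. -/

noncomputable section

theorem hasDerivWithinAt_integral_of_continuousOn_Icc {T : ℝ} (hT : 0 ≤ T) {f : ℝ → ℝ}
    (hf : ContinuousOn f (Set.Icc 0 T)) {t : ℝ} (ht : t ∈ Set.Icc 0 T) :
    HasDerivWithinAt (fun x => ∫ s in (0 : ℝ)..x, f s) (f t) (Set.Icc 0 T) t := by
  have hg : Continuous (Set.IccExtend hT ((Set.Icc 0 T).domRestrict f)) :=
    (continuousOn_iff_continuous_domRestrict.mp hf).Icc_extend'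
  have hfg : ∀ x ∈ Set.Icc 0 T, Set.IccExtend hT ((Set.Icc 0 T).domRestrict f) x = f x :=
    fun x hx => Set.IccExtend_of_mem hT _ hx
  have hd := (hg.integral_hasStrictDerivAt 0 t).hasDerivAt.hasDerivWithinAt (s := Set.Icc 0 T)
  rw [hfg t ht] at hd
  have hint : ∀ x ∈ Set.Icc 0 T, (∫ s in (0 : ℝ)..x, f s) =
      ∫ s in (0 : ℝ)..x, Set.IccExtend hT ((Set.Icc 0 T).domRestrict f) s := by
    intro x hx
    refine intervalIntegral.integral_congr fun s hs => ?_
    rw [Set.uIcc_of_le hx.1] at hs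
    exact (hfg s ⟨hs.1, hs.2.trans hx.2⟩).symm
  exact hd.congr hint (hint t ht)

/-- If `U' = -i h U` with `h` self-adjoint, then `U⋆ v` has derivative `i U⋆ h v`. -/
theorem hasDerivWithinAt_star_apply {d : ℕ} {U : ℝ → Op d} {A : Op d} {s : Set ℝ} {t : ℝ}
    (hA : IsSelfAdjoint A) (hU : HasDerivWithinAt U (-Complex.I • (A * U t)) s t) (v : E d) :
    HasDerivWithinAt (fun x => star (U x) v) (Complex.I • star (U t) (A v)) s t := by
  have h1 := hU.star
  have h2 := (((ContinuousLinearMap.apply ℂ (E d) v).restrictScalars ℝ).hasFDerivAt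
    (x := star (U t))).comp_hasDerivWithinAt t h1
  have hval : star (-Complex.I • (A * U t)) v = Complex.I • star (U t) (A v) := by
    rw [star_smul, star_mul, hA.star_eq]
    simp
  rw [← hval]
  exact h2

theorem inner_star_apply_star_apply {d : ℕ} {V : Op d} (hV : V ∈ unitary (Op d)) (x y : E d) :
    inner ℂ (star V x) (star V y) = inner ℂ x y := by
  rw [ContinuousLinearMap.star_eq_adjoint, ContinuousLinearMap.adjoint_inner_left,
    ← ContinuousLinearMap.star_eq_adjoint, ← mul_apply_eq_comp,
    Unitary.mul_star_self_of_mem hV, one_apply_eq_self]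

theorem ofReal_re_inner_apply_self {d : ℕ} {A : Op d} (hA : IsSelfAdjoint A) (v : E d) :
    (((inner ℂ v (A v)).re : ℝ) : ℂ) = inner ℂ v (A v) :=
  hA.isSymmetric.coe_re_inner_self_apply v

theorem observable_geometric_phase_holonomy (d : ℕ) (hd : 1 ≤ d) (T : ℝ) (hT : 0 ≤ T)
    (h : ℝ → Op d) (hhc : ContinuousOn h (Set.Icc (0 : ℝ) T))
    (hsa : ∀ t ∈ Set.Icc (0 : ℝ) T, IsSelfAdjoint (h t))
    (U : ℝ → Op d) (hU0 : U 0 = 1)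
    (hUu : ∀ t ∈ Set.Icc (0 : ℝ) T, U t ∈ unitary (Op d))
    (hUd : ∀ t ∈ Set.Icc (0 : ℝ) T,
      HasDerivWithinAt U (-Complex.I • (h t * U t)) (Set.Icc (0 : ℝ) T) t)
    (ψ : Fin d → E d) (hψ : Orthonormal ℂ ψ)
    (θ : Fin d → ℝ)
    (hcyc : ∀ n, (star (U T)) (ψ n) = Complex.exp ((θ n : ℝ) * Complex.I) • ψ n) :
    let δ : Fin d → ℝ → ℝ := fun n t => (inner (𝕜 := ℂ) (ψ n) ((h t) (ψ n))).re
    let ψt : Fin d → ℝ → E d := fun n t =>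
      Complex.exp (-(Complex.I * ((∫ s in (0 : ℝ)..t, δ n s : ℝ) : ℂ))) •
        (star (U t)) (ψ n)
    let β : Fin d → ℝ := fun n => θ n - ∫ s in (0 : ℝ)..T, δ n s
    -- (a) ψ̃_n is the parallel transport: it is differentiable with
    -- ⟨ψ̃_n(t), (d/dt)ψ̃_n(t)⟩ = 0
    (∀ n, ∃ w : ℝ → E d,
      (∀ t ∈ Set.Icc (0 : ℝ) T, HasDerivWithinAt (ψt n) (w t) (Set.Icc (0 : ℝ) T) t) ∧
      (∀ t ∈ Set.Icc (0 : ℝ) T, inner (𝕜 := ℂ) (ψt n t) (w t) = (0 : ℂ))) ∧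
    -- (b) the holonomy phase: ψ̃_n(T) = e^{iβ_n}ψ_n
    (∀ n, ψt n T = Complex.exp ((β n : ℝ) * Complex.I) • ψ n) := by
  intro δ ψt β
  refine ⟨fun n => ?_, fun n => ?_⟩
  · have hδ : ContinuousOn (δ n) (Set.Icc 0 T) :=
      Complex.continuous_re.comp_continuousOn
        ((innerSL ℂ (ψ n)).continuous.comp_continuousOn (hhc.clm_apply continuousOn_const))
    refine ⟨fun t => Complex.exp (-(Complex.I * ((∫ s in (0 : ℝ)..t, δ n s : ℝ) : ℂ))) •
      (Complex.I • star (U t) (h t (ψ n)) - (Complex.I * (δ n t : ℂ)) • star (U t) (ψ n)),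
      fun t ht => ?_, fun t ht => ?_⟩
    · have hphase := (((hasDerivWithinAt_integral_of_continuousOn_Icc hT hδ
        ht).ofReal_comp.const_mul Complex.I).neg).cexp
      refine (hphase.smul
        (hasDerivWithinAt_star_apply (hsa t ht) (hUd t ht) (ψ n))).congr_deriv ?_
      module
    · have hnorm : inner ℂ (ψ n) (ψ n) = (1 : ℂ) := by
        simp [inner_self_eq_norm_sq_to_K, hψ.1 n]
      have hre : (δ n t : ℂ) = inner ℂ (ψ n) (h t (ψ n)) :=
        ofReal_re_inner_apply_self (hsa t ht) (ψ n)
      simp only [ψt, inner_smul_left, inner_smul_right, inner_sub_right,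
        inner_star_apply_star_apply (hUu t ht), hnorm, hre]
      ring
  · simp only [ψt, β, hcyc n, smul_smul, ← Complex.exp_add]
    congr 2
    push_cast
    ring
end
end

section
/- Let (e_1,…,e_d) be an orthonormal basis of H, let Ũ : [0,T] → U(H) be continuously differentiable and horizontal, i.e. ⟨e_n, Ũ(t)⁻¹Ũ'(t) e_n⟩ = 0 for all n and t, and suppose Ũ(T)|e_n⟩ = e^{iβ_n} Ũ(0)|e_n⟩ for reals β_1,…,β_d. Let G = ∑_{n=1}^d e^{iθ_n}|e_{σ(n)}⟩⟨e_n| for a permutation σ of {1,…,d} and reals θ_n. Then V(t) = Ũ(t)G is also horizontal (⟨e_n, V(t)⁻¹V'(t) e_n⟩ = 0 for all n, t), and V(T)|e_n⟩ = e^{iβ_{σ(n)}} V(0)|e_n⟩ for each n. Hence the set of holonomy phases {β_n : 1 ≤ n ≤ d} (mod 2π) of the horizontal lift is independent of the choice of the starting point in the fiber: changing the starting point from Ũ(0) to Ũ(0)G only permutes the phases. -/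
/- STATEMENT 17: If Ũ is a horizontal C¹ curve of unitaries with
Ũ(T)e_n = e^{iβ_n}Ũ(0)e_n, and G = ∑_n e^{iθ_n}|e_{σ(n)}⟩⟨e_n| is a structure-group
element, then V(t) = Ũ(t)G is also horizontal and V(T)e_n = e^{iβ_{σ(n)}}V(0)e_n:
changing the starting point in the fiber only permutes the holonomy phases. -/

noncomputable section

/-- The rank-one operator `|x⟩⟨y| : h ↦ ⟨y, h⟩ x`. -/
def rankOne {d : ℕ} (x y : E d) : Op d :=
  (ContinuousLinearMap.toSpanSingleton ℂ x).comp (innerSL ℂ y)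

/-- On an orthonormal family, `∑ k, c k • |e (σ k)⟩⟨e k|` maps `e n` to `c n • e (σ n)`. -/
theorem sum_smul_rankOne_apply {d : ℕ} {e : Fin d → E d} (he : Orthonormal ℂ e)
    (σ : Fin d → Fin d) (c : Fin d → ℂ) (n : Fin d) :
    (∑ k, c k • rankOne (e (σ k)) (e k)) (e n) = c n • e (σ n) := by
  simp [rankOne, orthonormal_iff_ite.mp he]

theorem holonomy_phases_independent_of_starting_point (d : ℕ) (hd : 1 ≤ d)
    (T : ℝ) (hT : 0 ≤ T)
    (e : Fin d → E d) (he : Orthonormal ℂ e)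
    (Ut Ut' : ℝ → Op d)
    (hUd : ∀ t ∈ Set.Icc (0 : ℝ) T, HasDerivWithinAt Ut (Ut' t) (Set.Icc (0 : ℝ) T) t)
    (hUu : ∀ t ∈ Set.Icc (0 : ℝ) T, Ut t ∈ unitary (Op d))
    (hhor : ∀ n, ∀ t ∈ Set.Icc (0 : ℝ) T,
      inner (𝕜 := ℂ) (e n) ((star (Ut t) * Ut' t) (e n)) = (0 : ℂ))
    (β : Fin d → ℝ)
    (hβ : ∀ n, (Ut T) (e n) = Complex.exp ((β n : ℝ) * Complex.I) • (Ut 0) (e n))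
    (σ : Equiv.Perm (Fin d)) (θ : Fin d → ℝ) :
    let G : Op d := ∑ n, Complex.exp ((θ n : ℝ) * Complex.I) • rankOne (e (σ n)) (e n)
    let V : ℝ → Op d := fun t => Ut t * G
    -- V is differentiable with derivative Ũ'(t)G and is horizontal
    (∀ t ∈ Set.Icc (0 : ℝ) T, HasDerivWithinAt V (Ut' t * G) (Set.Icc (0 : ℝ) T) t) ∧
    (∀ n, ∀ t ∈ Set.Icc (0 : ℝ) T,
      inner (𝕜 := ℂ) (e n) ((star (V t) * (Ut' t * G)) (e n)) = (0 : ℂ)) ∧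
    -- the holonomy phases are permuted by σ
    (∀ n, (V T) (e n) = Complex.exp ((β (σ n) : ℝ) * Complex.I) • (V 0) (e n)) := by
  intro G V
  have hG : ∀ n, G (e n) = Complex.exp ((θ n : ℝ) * Complex.I) • e (σ n) :=
    sum_smul_rankOne_apply he σ _
  refine ⟨fun t ht => (hUd t ht).mul_const G, fun n t ht => ?_, fun n => ?_⟩
  · have h := hhor (σ n) t ht
    simp only [ContinuousLinearMap.star_eq_adjoint, mul_apply_eq_comp,
      ContinuousLinearMap.adjoint_inner_right] at h ⊢
    simp only [V, mul_apply_eq_comp, hG, map_smul, inner_smul_left,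
      inner_smul_right, h, mul_zero]
  · simp only [V, mul_apply_eq_comp, hG, map_smul, hβ]
    exact smul_comm _ _ _
end
end

section
/- For φ, β ∈ ℝ define the 2×2 unitary U_{φ,β} = e^{iβ}|ψ₊(φ)⟩⟨ψ₊(φ)| + e^{−iβ}|ψ₋(φ)⟩⟨ψ₋(φ)|. Then for all φ, φ', β, β' ∈ ℝ, the operators U_{φ,β} and U_{φ',β'} commute if and only if φ − φ' ∈ πℤ or β ∈ πℤ or β' ∈ πℤ; equivalently, U_{φ,β} and U_{φ',β'} do not commute exactly when φ ≠ φ' + kπ for every integer k and β, β' are not integer multiples of π. -/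
/- STATEMENT 18: The geometric gates U_{φ,β} = e^{iβ}|ψ₊(φ)⟩⟨ψ₊(φ)| +
e^{−iβ}|ψ₋(φ)⟩⟨ψ₋(φ)| commute iff φ − φ' ∈ πℤ or β ∈ πℤ or β' ∈ πℤ. -/

noncomputable section

open Real (pi)

abbrev M2 : Type := Matrix (Fin 2) (Fin 2) ℂ

/-- `ψ₊(φ) = (cos(φ/2), sin(φ/2))`. -/
def psiP (φ : ℝ) : Fin 2 → ℂ := ![(Real.cos (φ / 2) : ℂ), (Real.sin (φ / 2) : ℂ)]

/-- `ψ₋(φ) = (−sin(φ/2), cos(φ/2))`. -/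
def psiM (φ : ℝ) : Fin 2 → ℂ := ![(-Real.sin (φ / 2) : ℂ), (Real.cos (φ / 2) : ℂ)]

/-- The gate `U_{φ,β} = e^{iβ}|ψ₊(φ)⟩⟨ψ₊(φ)| + e^{−iβ}|ψ₋(φ)⟩⟨ψ₋(φ)|`. -/
def gateU (φ β : ℝ) : M2 :=
  Complex.exp ((β : ℝ) * Complex.I) • Matrix.vecMulVec (psiP φ) (star (psiP φ)) +
    Complex.exp (-((β : ℝ) * Complex.I)) • Matrix.vecMulVec (psiM φ) (star (psiM φ))

open Complex in
theorem gateU_eq (φ β : ℝ) :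
    gateU φ β = !![(Real.cos β : ℂ) + Real.sin β * Real.cos φ * I, Real.sin β * Real.sin φ * I;
      Real.sin β * Real.sin φ * I, Real.cos β - Real.sin β * Real.cos φ * I] := by
  have hsin : (Real.sin φ : ℂ) = 2 * Real.sin (φ / 2) * Real.cos (φ / 2) := by
    exact_mod_cast (congrArg Real.sin (by ring : 2 * (φ / 2) = φ)).symm.trans
      (Real.sin_two_mul (φ / 2))
  have hcos : (Real.cos φ : ℂ) = Real.cos (φ / 2) ^ 2 - Real.sin (φ / 2) ^ 2 := by
    exact_mod_cast (congrArg Real.cos (by ring : 2 * (φ / 2) = φ)).symm.trans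
      (Real.cos_two_mul' (φ / 2))
  have hone : (Real.sin (φ / 2) : ℂ) ^ 2 + Real.cos (φ / 2) ^ 2 = 1 := by
    exact_mod_cast Real.sin_sq_add_cos_sq (φ / 2)
  have hpos : exp (β * I) = Real.cos β + Real.sin β * I := by
    rw [exp_mul_I, ofReal_cos, ofReal_sin]
  have hneg : exp (-(β * I)) = Real.cos β - Real.sin β * I := by
    rw [← neg_mul, exp_mul_I, cos_neg, sin_neg, ofReal_cos, ofReal_sin]
    ring
  rw [gateU, hpos, hneg, hsin, hcos]
  ext i j
  fin_cases i <;> fin_cases j <;>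
    simp only [Matrix.add_apply, Matrix.smul_apply, Matrix.vecMulVec_apply, Pi.star_apply] <;>
    simp [psiP, psiM, -ofReal_cos, -ofReal_sin]
  · linear_combination (Real.cos β : ℂ) * hone
  · ring
  · ring
  · linear_combination (Real.cos β : ℂ) * hone

open Complex in
theorem commute_gateU_iff_sin (φ φ' β β' : ℝ) :
    Commute (gateU φ β) (gateU φ' β') ↔
      Real.sin (φ - φ') * (Real.sin β * Real.sin β') = 0 := by
  have key : Commute (gateU φ β) (gateU φ' β') ↔
      ((Real.sin (φ - φ') * (Real.sin β * Real.sin β') : ℝ) : ℂ) = 0 := by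
    rw [Real.sin_sub, commute_iff_eq, gateU_eq, gateU_eq, Matrix.mul_fin_two, Matrix.mul_fin_two]
    push_cast [-ofReal_cos, -ofReal_sin]
    constructor
    · intro h
      have h01 := congrFun (congrFun h 0) 1
      simp only [Matrix.of_apply, Matrix.cons_val_zero, Matrix.cons_val_one] at h01
      linear_combination (1 / 2 : ℂ) * h01 + (Real.sin φ * Real.cos φ' - Real.cos φ * Real.sin φ') *
        (Real.sin β * Real.sin β') * I_sq
    · intro h
      ext i j
      fin_cases i <;> fin_cases j <;> simp [-ofReal_cos, -ofReal_sin]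
      · ring
      · linear_combination -2 * I ^ 2 * h
      · linear_combination 2 * I ^ 2 * h
      · ring
  rw [key, ofReal_eq_zero]

theorem gates_commute_iff (φ φ' β β' : ℝ) :
    Commute (gateU φ β) (gateU φ' β') ↔
      (∃ k : ℤ, φ - φ' = k * pi) ∨ (∃ k : ℤ, β = k * pi) ∨ (∃ k : ℤ, β' = k * pi) := by
  rw [commute_gateU_iff_sin, mul_eq_zero, mul_eq_zero]
  simp only [Real.sin_eq_zero_iff, eq_comm (b := _ - _), eq_comm (b := β), eq_comm (b := β')]
end
end
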